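/- For all n ≥ 1, the sets 𝒮ₙ[3] and 𝒮ₙ[3]' are finite with card(𝒮ₙ[3]) = card(𝒮ₙ[3]') = 3·2^{2n+1}. -/

import Mathlib

noncomputable section

/-- The golden ratio τ = (1+√5)/2. -/
def gr : ℝ := (1 + Real.sqrt 5) / 2

/-- The ring ℤ[τ] as a subset of ℝ. -/
def Ztau : Set ℝ := {x : ℝ | ∃ a b : ℤ, x = (a : ℝ) + (b : ℝ) * gr}

/-- Congruence modulo 2ℤ[τ]. -/
def cong2 (x y : ℝ) : Prop := ∃ a b : ℤ, x - y = 2 * ((a : ℝ) + (b : ℝ) * gr)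

/-- The vector (1, τ', τ) (for t = τ; its conjugate for t = τ'). -/
def v3 (t : ℝ) : Fin 3 → ℝ := ![1, 1 - t, t]

/-- The three–dimensional spherical sets 𝒮ₙ[3] (t = τ) resp. 𝒮ₙ[3]' (t = τ'):
unit vectors in 2⁻ⁿℤ[τ]³ whose image mod 2 is a cyclic (= even) permutation
of (1, τ', τ) (resp. its conjugate). -/
def sphS3 (t : ℝ) (n : ℕ) : Set (Fin 3 → ℝ) :=
  {x | (∑ i, x i ^ 2) = 1 ∧ (∀ i, 2 ^ n * x i ∈ Ztau) ∧
    ∃ σ : Equiv.Perm (Fin 3), Equiv.Perm.sign σ = 1 ∧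
      ∀ i, cong2 (2 ^ n * x i) (v3 t (σ i))}

/-- The ring `ℤ[τ]` with exact arithmetic: `⟨a, b⟩` stands for `a + bτ`. -/
abbrev GoldenInt := QuadraticAlgebra ℤ 1 1

namespace GoldenInt

open scoped QuadraticAlgebra

/-- The element `τ` of `ℤ[τ]`. -/
def tau : GoldenInt := ⟨0, 1⟩

@[simp] lemma re_tau : tau.re = 0 := rfl

@[simp] lemma im_tau : tau.im = 1 := rfl

lemma two_dvd_iff (z : GoldenInt) : 2 ∣ z ↔ 2 ∣ z.re ∧ 2 ∣ z.im :=
  QuadraticAlgebra.algebraMap_dvd_iff (r := (2 : ℤ))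

lemma four_dvd_iff (z : GoldenInt) : 4 ∣ z ↔ 4 ∣ z.re ∧ 4 ∣ z.im :=
  QuadraticAlgebra.algebraMap_dvd_iff (r := (4 : ℤ))

lemma tau_sq : tau * tau = tau + 1 := by
  ext <;> simp

lemma two_cancel {x y : GoldenInt} (h : 2 * x = 2 * y) : x = y := by
  simpa [QuadraticAlgebra.ext_iff] using h

lemma four_cancel {x y : GoldenInt} (h : 4 * x = 4 * y) : x = y := by
  simpa [QuadraticAlgebra.ext_iff] using h

lemma two_dvd_or_of_mul {x y : GoldenInt} (h : 2 ∣ x * y) : 2 ∣ x ∨ 2 ∣ y := by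
  obtain ⟨a, b⟩ := x
  obtain ⟨c, d⟩ := y
  simp only [two_dvd_iff, QuadraticAlgebra.re_mul, QuadraticAlgebra.im_mul, one_mul] at h ⊢
  rcases Int.even_or_odd' a with ⟨a, rfl | rfl⟩ <;> rcases Int.even_or_odd' b with ⟨b, rfl | rfl⟩ <;>
  rcases Int.even_or_odd' c with ⟨c, rfl | rfl⟩ <;> rcases Int.even_or_odd' d with ⟨d, rfl | rfl⟩ <;>
  ring_nf at h <;> omega

/-- The scaled spherical set: vectors of square norm `4 ^ n` congruent modulo `2` to a multiple
of `(1, τ', τ)`, but not to zero. -/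
def sphere (n : ℕ) : Set (GoldenInt × GoldenInt × GoldenInt) :=
  {v | v.1 ^ 2 + v.2.1 ^ 2 + v.2.2 ^ 2 = 4 ^ n ∧
    ¬ 2 ∣ v.1 ∧ 2 ∣ v.2.1 - (1 - tau) * v.1 ∧ 2 ∣ v.2.2 - tau * v.1}

/-- Vectors of square norm `4 ^ n` whose scalar product with `(1, τ', τ)` is not divisible
by `2`. -/
def oddSphere (n : ℕ) : Set (GoldenInt × GoldenInt × GoldenInt) :=
  {v | v.1 ^ 2 + v.2.1 ^ 2 + v.2.2 ^ 2 = 4 ^ n ∧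
    ¬ 2 ∣ v.1 + (1 - tau) * v.2.1 + tau * v.2.2}

/-- The scalar product of `v` with `(1, ε τ', δ τ)`. -/
def dotSign (e : ℤˣ × ℤˣ) (v : GoldenInt × GoldenInt × GoldenInt) : GoldenInt :=
  v.1 + (e.1 : ℤ) * (1 - tau) * v.2.1 + (e.2 : ℤ) * tau * v.2.2

/-- Twice the reflection of `v` in the hyperplane orthogonal to `(1, ε τ', δ τ)`. -/
def reflSign (p : (GoldenInt × GoldenInt × GoldenInt) × ℤˣ × ℤˣ) :
    GoldenInt × GoldenInt × GoldenInt :=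
  (2 * p.1.1 - dotSign p.2 p.1,
    2 * p.1.2.1 - dotSign p.2 p.1 * ((p.2.1 : ℤ) * (1 - tau)),
    2 * p.1.2.2 - dotSign p.2 p.1 * ((p.2.2 : ℤ) * tau))

lemma unit_cast_sq (u : ℤˣ) : ((u : ℤ) : GoldenInt) * ((u : ℤ) : GoldenInt) = 1 := by
  rcases Int.units_eq_one_or u with rfl | rfl <;> simp

lemma dotSign_reflSign (v : GoldenInt × GoldenInt × GoldenInt) (e : ℤˣ × ℤˣ) :
    dotSign e (reflSign (v, e)) = -2 * dotSign e v := by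
  have h1 := unit_cast_sq e.1
  have h2 := unit_cast_sq e.2
  have h3 := tau_sq
  simp only [reflSign]
  set D := dotSign e v with hD
  simp only [dotSign] at hD ⊢
  linear_combination (-2) * hD - D * (1 - tau) ^ 2 * h1 - D * tau ^ 2 * h2 - 2 * D * h3

lemma norm_reflSign (v : GoldenInt × GoldenInt × GoldenInt) (e : ℤˣ × ℤˣ) :
    (reflSign (v, e)).1 ^ 2 + (reflSign (v, e)).2.1 ^ 2 + (reflSign (v, e)).2.2 ^ 2 =
      4 * (v.1 ^ 2 + v.2.1 ^ 2 + v.2.2 ^ 2) := by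
  have h1 := unit_cast_sq e.1
  have h2 := unit_cast_sq e.2
  have h3 := tau_sq
  simp only [reflSign]
  set D := dotSign e v with hD
  simp only [dotSign] at hD
  linear_combination (4 * D) * hD + D ^ 2 * (1 - tau) ^ 2 * h1 + D ^ 2 * tau ^ 2 * h2
    + 2 * D ^ 2 * h3

lemma reflSign_reflSign (v : GoldenInt × GoldenInt × GoldenInt) (e : ℤˣ × ℤˣ) :
    reflSign (reflSign (v, e), e) = (4 * v.1, 4 * v.2.1, 4 * v.2.2) := by
  have h := dotSign_reflSign v e
  ext1
  · simp only [reflSign] at h ⊢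
    linear_combination -h
  · ext1
    · simp only [reflSign] at h ⊢
      linear_combination -((e.1 : ℤ) * (1 - tau)) * h
    · simp only [reflSign] at h ⊢
      linear_combination -((e.2 : ℤ) * tau) * h

lemma two_dvd_dotSign_sub (v : GoldenInt × GoldenInt × GoldenInt) (e : ℤˣ × ℤˣ) :
    2 ∣ dotSign e v - (v.1 + (1 - tau) * v.2.1 + tau * v.2.2) := by
  obtain ⟨⟨a, b⟩, ⟨c, d⟩, ⟨i, j⟩⟩ := v
  obtain ⟨s, t⟩ := e
  rcases Int.units_eq_one_or s with rfl | rfl <;> rcases Int.units_eq_one_or t with rfl | rfl <;>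
  simp [dotSign, two_dvd_iff] <;> omega

lemma two_dvd_dotSign_iff (v : GoldenInt × GoldenInt × GoldenInt) (e : ℤˣ × ℤˣ) :
    2 ∣ dotSign e v ↔ 2 ∣ v.1 + (1 - tau) * v.2.1 + tau * v.2.2 :=
  dvd_iff_dvd_of_dvd_sub (two_dvd_dotSign_sub v e)

lemma reflSign_mapsTo (n : ℕ) :
    Set.MapsTo reflSign (oddSphere n ×ˢ Set.univ) (sphere (n + 1)) := by
  rintro ⟨v, e⟩ ⟨⟨hn, hv⟩, -⟩
  refine ⟨?_, ?_, ?_, ?_⟩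
  · rw [norm_reflSign, hn, pow_succ']
  · rw [← two_dvd_dotSign_iff v e] at hv
    simpa [reflSign, dvd_sub_right] using hv
  all_goals
    simp only [reflSign]
    generalize dotSign e v = D
    obtain ⟨⟨a, b⟩, ⟨c, d⟩, ⟨i, j⟩⟩ := v
    obtain ⟨s, t⟩ := e
    obtain ⟨p, q⟩ := D
    rcases Int.units_eq_one_or s with rfl | rfl <;>
    rcases Int.units_eq_one_or t with rfl | rfl <;>
    simp [two_dvd_iff] <;> omega

/-- For a vector congruent to a nonzero multiple of `(1, τ', τ)` modulo `2`, exactly one choice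
of signs gives the scalar product `2 v.1` modulo `4`. -/
lemma sign_unique {v : GoldenInt × GoldenInt × GoldenInt} (h1 : ¬ 2 ∣ v.1)
    (h2 : 2 ∣ v.2.1 - (1 - tau) * v.1) (h3 : 2 ∣ v.2.2 - tau * v.1) {e e' : ℤˣ × ℤˣ}
    {m m' : GoldenInt} (he : dotSign e v - 2 * v.1 = 4 * m)
    (he' : dotSign e' v - 2 * v.1 = 4 * m') : e = e' := by
  obtain ⟨⟨a, b⟩, ⟨c, d⟩, ⟨i, j⟩⟩ := v
  obtain ⟨s, t⟩ := e
  obtain ⟨s', t'⟩ := e'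
  obtain ⟨p, q⟩ := m
  obtain ⟨p', q'⟩ := m'
  rcases Int.units_eq_one_or s with rfl | rfl <;> rcases Int.units_eq_one_or t with rfl | rfl <;>
  rcases Int.units_eq_one_or s' with rfl | rfl <;>
  rcases Int.units_eq_one_or t' with rfl | rfl <;>
  first
  | rfl
  | exfalso
    simp [dotSign, two_dvd_iff, QuadraticAlgebra.ext_iff] at h1 h2 h3 he he'
    omega

lemma sign_exists {v : GoldenInt × GoldenInt × GoldenInt} (h1 : ¬ 2 ∣ v.1)
    (h2 : 2 ∣ v.2.1 - (1 - tau) * v.1) (h3 : 2 ∣ v.2.2 - tau * v.1) :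
    ∃ e : ℤˣ × ℤˣ, 4 ∣ dotSign e v - 2 * v.1 := by
  by_contra! H
  obtain ⟨⟨a, b⟩, ⟨c, d⟩, ⟨i, j⟩⟩ := v
  have e1 := H (1, 1)
  have e2 := H (1, -1)
  have e3 := H (-1, 1)
  have e4 := H (-1, -1)
  clear H
  simp [dotSign, two_dvd_iff, four_dvd_iff] at h1 h2 h3 e1 e2 e3 e4
  obtain ⟨⟨k, hk⟩, ⟨l, hl⟩⟩ := h2
  obtain ⟨⟨m, hm⟩, ⟨n, hn⟩⟩ := h3
  obtain rfl : d = 2 * l - a := by linarith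
  obtain rfl : c = 2 * k + a - b := by linarith
  obtain rfl : i = 2 * m + b := by linarith
  obtain rfl : j = 2 * n + a + b := by linarith
  clear hk hl hm hn
  rcases Int.even_or_odd' a with ⟨a, rfl | rfl⟩ <;> rcases Int.even_or_odd' b with ⟨b, rfl | rfl⟩ <;>
  omega

lemma reflSign_injOn (n : ℕ) : Set.InjOn reflSign (oddSphere n ×ˢ Set.univ) := by
  rintro ⟨v, e⟩ hv ⟨v', e'⟩ hv' h
  obtain ⟨-, h1, h2, h3⟩ := reflSign_mapsTo n hv
  have key (w : GoldenInt × GoldenInt × GoldenInt) (f : ℤˣ × ℤˣ) :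
      dotSign f (reflSign (w, f)) - 2 * (reflSign (w, f)).1 = 4 * (-w.1) := by
    rw [dotSign_reflSign]
    simp only [reflSign]
    ring
  have he : e = e' := sign_unique h1 h2 h3 (key v e) (h ▸ key v' e')
  subst he
  have := congrArg (fun w => reflSign (w, e)) h
  simp only [reflSign_reflSign] at this
  obtain ⟨⟨a, b⟩, ⟨c, d⟩, ⟨i, j⟩⟩ := v
  obtain ⟨⟨a', b'⟩, ⟨c', d'⟩, ⟨i', j'⟩⟩ := v'
  simpa [QuadraticAlgebra.ext_iff] using this

lemma reflSign_surjOn (n : ℕ) :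
    Set.SurjOn reflSign (oddSphere n ×ˢ Set.univ) (sphere (n + 1)) := by
  rintro v ⟨hn, h1, h2, h3⟩
  obtain ⟨e, m, hm⟩ := sign_exists h1 h2 h3
  have hw : ∃ w : GoldenInt × GoldenInt × GoldenInt,
      reflSign (v, e) = (4 * w.1, 4 * w.2.1, 4 * w.2.2) := by
    have hD : dotSign e v = 2 * v.1 + 4 * m := by linear_combination hm
    obtain ⟨k, hk⟩ := h2
    obtain ⟨l, hl⟩ := h3
    obtain ⟨p, hp⟩ : ∃ p, v.2.1 - (v.1 + 2 * m) * ((e.1 : ℤ) * (1 - tau)) = 2 * p := by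
      rcases Int.units_eq_one_or e.1 with h | h <;> rw [h]
      · exact ⟨k - m * (1 - tau), by push_cast; linear_combination hk⟩
      · exact ⟨k + (v.1 + m) * (1 - tau), by push_cast; linear_combination hk⟩
    obtain ⟨q, hq⟩ : ∃ q, v.2.2 - (v.1 + 2 * m) * ((e.2 : ℤ) * tau) = 2 * q := by
      rcases Int.units_eq_one_or e.2 with h | h <;> rw [h]
      · exact ⟨l - m * tau, by push_cast; linear_combination hl⟩
      · exact ⟨l + (v.1 + m) * tau, by push_cast; linear_combination hl⟩
    refine ⟨(-m, p, q), ?_⟩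
    simp only [reflSign, hD, Prod.mk.injEq]
    exact ⟨by ring, by linear_combination 2 * hp, by linear_combination 2 * hq⟩
  obtain ⟨w, hw⟩ := hw
  have hwv : reflSign (w, e) = v := by
    have h := reflSign_reflSign v e
    rw [hw] at h
    simp only [reflSign, dotSign, Prod.mk.injEq] at h
    ext1
    · apply four_cancel
      simp only [reflSign, dotSign]
      linear_combination h.1
    · ext1 <;> apply four_cancel <;> simp only [reflSign, dotSign]
      · linear_combination h.2.1
      · linear_combination h.2.2
  subst hwv
  refine ⟨(w, e), ⟨⟨?_, ?_⟩, Set.mem_univ _⟩, rfl⟩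
  · apply four_cancel
    rw [← norm_reflSign w e, hn, pow_succ']
  · rw [← two_dvd_dotSign_iff w e]
    intro h
    apply h1
    simp only [reflSign]
    exact dvd_sub (dvd_mul_right _ _) h

lemma reflSign_bijOn (n : ℕ) :
    Set.BijOn reflSign (oddSphere n ×ˢ Set.univ) (sphere (n + 1)) :=
  ⟨reflSign_mapsTo n, reflSign_injOn n, reflSign_surjOn n⟩

/-- Exchanging the last two coordinates. -/
def swapYZ (v : GoldenInt × GoldenInt × GoldenInt) : GoldenInt × GoldenInt × GoldenInt :=
  (v.1, v.2.2, v.2.1)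

lemma two_dvd_and_of_four_dvd {x y z : GoldenInt} (h : 4 ∣ x ^ 2 + y ^ 2 + z ^ 2)
    (hd : ¬ 2 ∣ x + (1 - tau) * y + tau * z) :
    ¬ 2 ∣ x ∧ 2 ∣ y - tau * x ∧ 2 ∣ z - (1 - tau) * x := by
  have h3 := tau_sq
  obtain ⟨m, hm⟩ := h
  have hs : 2 ∣ x + y + z := by
    have : 2 ∣ (x + y + z) * (x + y + z) :=
      ⟨2 * m + x * y + y * z + x * z, by linear_combination hm⟩
    simpa using two_dvd_or_of_mul this
  obtain ⟨k, hk⟩ := hs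
  obtain rfl : z = 2 * k - x - y := by linear_combination hk
  have hp : 2 ∣ (y - tau * x) * (y - (1 - tau) * x) := by
    refine ⟨m - k ^ 2 + k * (x + y) - x * y - x ^ 2, ?_⟩
    have four : (2 : GoldenInt) * ((y - tau * x) * (y - (1 - tau) * x)) =
        2 * (2 * (m - k ^ 2 + k * (x + y) - x * y - x ^ 2)) := by
      linear_combination hm - 2 * x ^ 2 * h3
    exact two_cancel four
  rcases two_dvd_or_of_mul hp with ⟨l, hl⟩ | ⟨l, hl⟩
  · have hz : 2 ∣ 2 * k - x - y - (1 - tau) * x := ⟨k - l - x, by linear_combination -hl⟩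
    refine ⟨?_, ⟨l, hl⟩, hz⟩
    rintro ⟨r, rfl⟩
    obtain ⟨s, hs⟩ := hz
    apply hd
    exact ⟨r + (1 - tau) * (l + tau * r) + tau * (s + (1 - tau) * r),
      by linear_combination (1 - tau) * hl + tau * hs⟩
  · refine absurd ⟨(1 - tau) ^ 2 * x + tau * k + (1 - 2 * tau) * l, ?_⟩ hd
    linear_combination (1 - 2 * tau) * hl

lemma swapYZ_image_sphere {n : ℕ} (hn : 1 ≤ n) : swapYZ '' sphere n = oddSphere n := by
  obtain ⟨n, rfl⟩ := Nat.exists_eq_add_of_le' hn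
  ext ⟨x, y, z⟩
  constructor
  · rintro ⟨⟨x, z, y⟩, ⟨h, h1, h2, h3⟩, ⟨⟩⟩
    refine ⟨by simp only at h ⊢; rw [← h]; ring, ?_⟩
    obtain ⟨a, b⟩ := x
    obtain ⟨c, d⟩ := y
    obtain ⟨i, j⟩ := z
    simp [two_dvd_iff] at h1 h2 h3 ⊢
    omega
  · rintro ⟨h, hd⟩
    simp only at h hd
    obtain ⟨h1, h2, h3⟩ := two_dvd_and_of_four_dvd (h ▸ Dvd.intro_left _ (pow_succ 4 n).symm) hd
    exact ⟨(x, z, y), ⟨by simp only; rw [← h]; ring, h1, h3, h2⟩, rfl⟩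

lemma swapYZ_injective : Function.Injective swapYZ := by
  rintro ⟨x, y, z⟩ ⟨x', y', z'⟩ h
  simp only [swapYZ, Prod.mk.injEq] at h ⊢
  tauto

/-- The vectors `±e₁, ±e₂, ±e₃`. -/
def unitVectors : Finset (GoldenInt × GoldenInt × GoldenInt) :=
  {(1, 0, 0), (-1, 0, 0), (0, 1, 0), (0, -1, 0), (0, 0, 1), (0, 0, -1)}

lemma card_unitVectors : unitVectors.card = 6 := by decide

lemma oddSphere_zero : oddSphere 0 = unitVectors := by
  ext ⟨⟨a, b⟩, ⟨c, d⟩, ⟨i, j⟩⟩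
  constructor
  · rintro ⟨h, -⟩
    simp [QuadraticAlgebra.ext_iff, pow_two] at h
    obtain ⟨h1, h2⟩ := h
    have nonneg := fun x : ℤ => mul_self_nonneg x
    have even : 2 ∣ b * b + d * d + j * j :=
      ⟨-(a * b + c * d + i * j), by linear_combination h2⟩
    have na := nonneg a
    have nb := nonneg b
    have nc := nonneg c
    have nd := nonneg d
    have ni := nonneg i
    have nj := nonneg j
    obtain rfl : b = 0 := mul_self_eq_zero.mp (by omega)
    obtain rfl : d = 0 := mul_self_eq_zero.mp (by omega)
    obtain rfl : j = 0 := mul_self_eq_zero.mp (by omega)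
    have cases {x : ℤ} (hx : x * x ≤ 1) : x = 0 ∨ x = 1 ∨ x = -1 := by
      have : -1 ≤ x := by nlinarith
      have : x ≤ 1 := by nlinarith
      omega
    rcases cases (x := a) (by omega) with rfl | rfl | rfl <;>
    rcases cases (x := c) (by omega) with rfl | rfl | rfl <;>
    rcases cases (x := i) (by omega) with rfl | rfl | rfl <;>
    first
    | (exfalso; omega)
    | (simp [unitVectors, QuadraticAlgebra.ext_iff])
  · intro h
    simp only [unitVectors, Finset.coe_insert, Finset.coe_singleton, Set.mem_insert_iff,
      Set.mem_singleton_iff] at h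
    rcases h with h | h | h | h | h | h <;> rw [h] <;>
    simp [oddSphere, two_dvd_iff]

lemma ncard_sphere_succ (n : ℕ) : (sphere (n + 1)).ncard = (oddSphere n).ncard * 4 := by
  rw [← (reflSign_bijOn n).ncard_eq, Set.ncard_prod, Set.ncard_univ]
  simp

lemma finite_sphere_succ {n : ℕ} (h : (oddSphere n).Finite) : (sphere (n + 1)).Finite := by
  rw [← (reflSign_bijOn n).image_eq]
  exact (h.prod Set.finite_univ).image _

lemma sphere_succ_finite_and_ncard (n : ℕ) :
    (sphere (n + 1)).Finite ∧ (sphere (n + 1)).ncard = 24 * 4 ^ n := by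
  induction n with
  | zero =>
    refine ⟨finite_sphere_succ ?_, ?_⟩
    · rw [oddSphere_zero]
      exact Finset.finite_toSet _
    · rw [ncard_sphere_succ, oddSphere_zero, Set.ncard_coe_finset, card_unitVectors]
      norm_num
  | succ n ih =>
    have h : swapYZ '' sphere (n + 1) = oddSphere (n + 1) := swapYZ_image_sphere (by omega)
    refine ⟨finite_sphere_succ (h ▸ ih.1.image _), ?_⟩
    rw [ncard_sphere_succ, ← h, Set.ncard_image_of_injective _ swapYZ_injective, ih.2]
    ring

lemma gr_sq : gr * gr = gr + 1 := by
  have := Real.goldenRatio_sq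
  rw [pow_two] at this
  exact this

/-- The embedding of `ℤ[τ]` in the reals. -/
def toReal : GoldenInt →+* ℝ where
  toFun z := z.re + z.im * gr
  map_one' := by simp
  map_zero' := by simp
  map_add' x y := by simp; ring
  map_mul' x y := by
    simp
    linear_combination (-(x.im * y.im : ℝ)) * gr_sq

lemma toReal_apply (z : GoldenInt) : toReal z = z.re + z.im * gr := rfl

lemma toReal_tau : toReal tau = gr := by simp [toReal_apply]

lemma toReal_injective : Function.Injective toReal := by
  rw [injective_iff_map_eq_zero]
  rintro ⟨a, b⟩ h
  rw [toReal_apply] at h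
  simp only at h
  have hb : b = 0 := by
    by_contra hb
    exact ((Real.goldenRatio_irrational.intCast_mul hb).intCast_add a).ne_zero h
  subst hb
  simpa [QuadraticAlgebra.ext_iff] using h

lemma mem_Ztau_iff (x : ℝ) : x ∈ Ztau ↔ ∃ z, toReal z = x :=
  ⟨fun ⟨a, b, h⟩ => ⟨⟨a, b⟩, h.symm⟩, fun ⟨z, h⟩ => ⟨z.re, z.im, h.symm⟩⟩

lemma cong2_toReal_iff (z w : GoldenInt) : cong2 (toReal z) (toReal w) ↔ 2 ∣ z - w := by
  constructor
  · rintro ⟨a, b, h⟩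
    refine ⟨⟨a, b⟩, toReal_injective ?_⟩
    rw [map_sub, map_mul, map_ofNat, h, toReal_apply]
  · rintro ⟨k, h⟩
    refine ⟨k.re, k.im, ?_⟩
    rw [← toReal_apply, ← map_sub, h, map_mul, map_ofNat]

/-- The vector of the unit sphere with coordinates `2⁻ⁿ v`. -/
def toSphere (n : ℕ) (v : GoldenInt × GoldenInt × GoldenInt) : Fin 3 → ℝ :=
  ![toReal v.1 / 2 ^ n, toReal v.2.1 / 2 ^ n, toReal v.2.2 / 2 ^ n]

lemma toSphere_injective (n : ℕ) : Function.Injective (toSphere n) := by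
  rintro ⟨x, y, z⟩ ⟨x', y', z'⟩ h
  have h0 := congrFun h 0
  have h1 := congrFun h 1
  have h2 := congrFun h 2
  simp only [toSphere, Matrix.cons_val] at h0 h1 h2
  rw [div_left_inj' (by positivity)] at h0 h1 h2
  rw [toReal_injective h0, toReal_injective h1, toReal_injective h2]

/-- The classes modulo `2` of the cyclic permutations of `(1, τ', τ)` are the nonzero multiples
of `(1, τ', τ)`. -/
lemma exists_even_perm_iff (v : GoldenInt × GoldenInt × GoldenInt) :
    (∃ σ : Equiv.Perm (Fin 3), Equiv.Perm.sign σ = 1 ∧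
      ∀ i, 2 ∣ ![v.1, v.2.1, v.2.2] i - ![1, 1 - tau, tau] (σ i)) ↔
    ¬ 2 ∣ v.1 ∧ 2 ∣ v.2.1 - (1 - tau) * v.1 ∧ 2 ∣ v.2.2 - tau * v.1 := by
  obtain ⟨⟨a, b⟩, ⟨c, d⟩, ⟨i, j⟩⟩ := v
  constructor
  · rintro ⟨σ, hσ, h⟩
    have hcases : ∀ σ : Equiv.Perm (Fin 3), Equiv.Perm.sign σ = 1 →
        (σ 0 = 0 ∧ σ 1 = 1 ∧ σ 2 = 2) ∨ (σ 0 = 1 ∧ σ 1 = 2 ∧ σ 2 = 0) ∨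
        (σ 0 = 2 ∧ σ 1 = 0 ∧ σ 2 = 1) := by decide
    have h0 := h 0
    have h1 := h 1
    have h2 := h 2
    rcases hcases σ hσ with ⟨e0, e1, e2⟩ | ⟨e0, e1, e2⟩ | ⟨e0, e1, e2⟩ <;>
    rw [e0] at h0 <;> rw [e1] at h1 <;> rw [e2] at h2 <;>
    simp [two_dvd_iff] at h0 h1 h2 ⊢ <;> omega
  · intro h
    simp [two_dvd_iff] at h
    rcases Int.emod_two_eq_zero_or_one b with hb | hb
    · refine ⟨1, by simp, fun k => ?_⟩
      fin_cases k <;> simp [two_dvd_iff] <;> omega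
    · rcases Int.emod_two_eq_zero_or_one a with ha | ha
      · refine ⟨finRotate 3 * finRotate 3, by decide, fun k => ?_⟩
        have e0 : (finRotate 3 * finRotate 3 : Equiv.Perm (Fin 3)) 0 = 2 := by decide
        have e1 : (finRotate 3 * finRotate 3 : Equiv.Perm (Fin 3)) 1 = 0 := by decide
        have e2 : (finRotate 3 * finRotate 3 : Equiv.Perm (Fin 3)) 2 = 1 := by decide
        match k with
        | 0 => rw [e0]; simp [two_dvd_iff]; omega
        | 1 => rw [e1]; simp [two_dvd_iff]; omega
        | 2 => rw [e2]; simp [two_dvd_iff]; omega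
      · refine ⟨finRotate 3, by decide, fun k => ?_⟩
        have e0 : finRotate 3 0 = 1 := by decide
        have e1 : finRotate 3 1 = 2 := by decide
        have e2 : finRotate 3 2 = 0 := by decide
        match k with
        | 0 => rw [e0]; simp [two_dvd_iff]; omega
        | 1 => rw [e1]; simp [two_dvd_iff]; omega
        | 2 => rw [e2]; simp [two_dvd_iff]; omega

lemma toReal_v3 (i : Fin 3) : toReal (![1, 1 - tau, tau] i) = v3 gr i := by
  fin_cases i <;> simp [v3, toReal_tau]

lemma two_pow_mul_toSphere (n : ℕ) (v : GoldenInt × GoldenInt × GoldenInt) (i : Fin 3) :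
    2 ^ n * toSphere n v i = toReal (![v.1, v.2.1, v.2.2] i) := by
  fin_cases i <;> simp [toSphere] <;> field_simp

lemma toSphere_mem_iff (n : ℕ) (v : GoldenInt × GoldenInt × GoldenInt) :
    toSphere n v ∈ sphS3 gr n ↔ v ∈ sphere n := by
  have hnorm : ∑ i, toSphere n v i ^ 2 = 1 ↔ v.1 ^ 2 + v.2.1 ^ 2 + v.2.2 ^ 2 = 4 ^ n := by
    have h4 : (4 : ℝ) ^ n = (2 ^ n) ^ 2 := by rw [← pow_mul, mul_comm, pow_mul]; norm_num
    rw [← toReal_injective.eq_iff]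
    simp only [Fin.sum_univ_three, toSphere, Matrix.cons_val, map_add, map_pow, map_ofNat, h4]
    field_simp
  have hmem : ∀ i, 2 ^ n * toSphere n v i ∈ Ztau := fun i => by
    rw [two_pow_mul_toSphere, mem_Ztau_iff]
    exact ⟨_, rfl⟩
  simp only [sphS3, sphere, Set.mem_ofPred_eq, hnorm, hmem, implies_true, true_and,
    ← exists_even_perm_iff]
  simp only [two_pow_mul_toSphere, ← toReal_v3, cong2_toReal_iff]

lemma toSphere_image (n : ℕ) : toSphere n '' sphere n = sphS3 gr n := by
  apply Set.Subset.antisymm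
  · rintro _ ⟨v, hv, rfl⟩
    exact (toSphere_mem_iff n v).mpr hv
  · intro x hx
    choose z hz using fun i => (mem_Ztau_iff _).mp (hx.2.1 i)
    have hzx : toSphere n (z 0, z 1, z 2) = x := by
      ext i
      fin_cases i <;> simp [toSphere, hz]
    exact ⟨_, (toSphere_mem_iff n _).mp (hzx ▸ hx), hzx⟩

end GoldenInt

/-- Exchanging two coordinates turns the sets for `t` into the sets for `1 - t`. -/
lemma comp_swap_mem_sphS3 {t : ℝ} {n : ℕ} {x : Fin 3 → ℝ} (hx : x ∈ sphS3 t n) :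
    x ∘ Equiv.swap 1 2 ∈ sphS3 (1 - t) n := by
  obtain ⟨h1, h2, σ, hσ, h3⟩ := hx
  refine ⟨?_, fun i => h2 _, Equiv.swap 1 2 * σ * Equiv.swap 1 2, ?_, fun i => ?_⟩
  · rw [← h1]
    exact Equiv.sum_comp (Equiv.swap (1 : Fin 3) 2) (fun i => x i ^ 2)
  · rw [map_mul, map_mul, hσ, mul_one, ← map_mul, Equiv.swap_mul_self, map_one]
  · have hv (j : Fin 3) : v3 (1 - t) (Equiv.swap 1 2 j) = v3 t j := by
      have e1 : Equiv.swap (1 : Fin 3) 2 0 = 0 := by decide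
      fin_cases j <;> simp [v3, e1]
    simpa only [Equiv.Perm.mul_apply, Function.comp_apply, hv] using h3 (Equiv.swap 1 2 i)

lemma image_swap_sphS3 (t : ℝ) (n : ℕ) :
    (fun x : Fin 3 → ℝ => x ∘ Equiv.swap 1 2) '' sphS3 t n = sphS3 (1 - t) n := by
  apply Set.Subset.antisymm
  · rintro _ ⟨x, hx, rfl⟩
    exact comp_swap_mem_sphS3 hx
  · intro x hx
    refine ⟨x ∘ Equiv.swap 1 2, ?_, ?_⟩
    · simpa using comp_swap_mem_sphS3 hx
    · ext i
      simp

theorem statement11 (n : ℕ) (hn : 1 ≤ n) :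
    (sphS3 gr n).Finite ∧ (sphS3 (1 - gr) n).Finite ∧
    (sphS3 gr n).ncard = 3 * 2 ^ (2 * n + 1) ∧
    (sphS3 (1 - gr) n).ncard = 3 * 2 ^ (2 * n + 1) := by
  obtain ⟨n, rfl⟩ := Nat.exists_eq_add_of_le' hn
  obtain ⟨hfin, hcard⟩ := GoldenInt.sphere_succ_finite_and_ncard n
  have hfin' : (sphS3 gr (n + 1)).Finite := by
    rw [← GoldenInt.toSphere_image]
    exact hfin.image _
  have hcard' : (sphS3 gr (n + 1)).ncard = 3 * 2 ^ (2 * (n + 1) + 1) := by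
    rw [← GoldenInt.toSphere_image,
      Set.ncard_image_of_injective _ (GoldenInt.toSphere_injective _), hcard,
      show 2 * (n + 1) + 1 = 2 * n + 3 by ring, pow_add, pow_mul]
    norm_num
    ring
  have hinj : Function.Injective (fun x : Fin 3 → ℝ => x ∘ Equiv.swap 1 2) :=
    (Equiv.swap 1 2).surjective.injective_comp_right
  rw [← image_swap_sphS3 gr, Set.ncard_image_of_injective _ hinj]
  exact ⟨hfin', hfin'.image _, hcard', hcard'⟩
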